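/- arXiv:2208.12245 — 2 statements merged into one kernel-verified Lean document; each statement's English description precedes it below -/
import Mathlib

section
/- Let α ∈ (0, 1/9). Then g_α(x̄_α) = ∫_{x̲_α}^{x̄_α} log(f_α(t)) dt > 0. -/
open Finset

/-- `f_α(x) = (1−α)x(1−x)/(α+(1−α)x²)`. -/
noncomputable def f (α x : ℝ) : ℝ := (1 - α) * x * (1 - x) / (α + (1 - α) * x ^ 2)

/-- `x̲_α = (1/4)(1 − sqrt(1 − 8α/(1−α)))`. -/
noncomputable def xlo (α : ℝ) : ℝ := (1 / 4) * (1 - Real.sqrt (1 - 8 * α / (1 - α)))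

/-- `x̄_α = (1/4)(1 + sqrt(1 − 8α/(1−α)))`. -/
noncomputable def xhi (α : ℝ) : ℝ := (1 / 4) * (1 + Real.sqrt (1 - 8 * α / (1 - α)))

/-- `g_α(x) = ∫_{x̲_α}^{x} log(f_α(t)) dt`. -/
noncomputable def g (α x : ℝ) : ℝ := ∫ t in (xlo α)..x, Real.log (f α t)

theorem xlo_lt_xhi {α : ℝ} (hα : α ∈ Set.Ioo (0 : ℝ) (1 / 9)) : xlo α < xhi α := by
  obtain ⟨h0, h1⟩ := hα
  have hs : 0 < Real.sqrt (1 - 8 * α / (1 - α)) := by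
    rw [Real.sqrt_pos, sub_pos, div_lt_one (by linarith)]
    linarith
  unfold xlo xhi
  linarith

theorem xlo_pos {α : ℝ} (hα : α ∈ Set.Ioo (0 : ℝ) (1 / 9)) : 0 < xlo α := by
  obtain ⟨h0, h1⟩ := hα
  have hs : Real.sqrt (1 - 8 * α / (1 - α)) < 1 := by
    rw [Real.sqrt_lt' one_pos]
    have : 0 < 8 * α / (1 - α) := div_pos (by linarith) (by linarith)
    linarith
  unfold xlo
  linarith

theorem xlo_add_xhi (α : ℝ) : xlo α + xhi α = 1 / 2 := by
  unfold xlo xhi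
  ring

theorem one_sub_mul_xlo_mul_xhi {α : ℝ} (hα : α ∈ Set.Ioo (0 : ℝ) (1 / 9)) :
    (1 - α) * (2 * (xlo α * xhi α)) = α := by
  obtain ⟨h0, h1⟩ := hα
  have hne : 1 - α ≠ 0 := by linarith
  have hs : Real.sqrt (1 - 8 * α / (1 - α)) ^ 2 = 1 - 8 * α / (1 - α) := by
    apply Real.sq_sqrt
    rw [sub_nonneg, div_le_one (by linarith)]
    linarith
  have h : xlo α * xhi α = (1 - Real.sqrt (1 - 8 * α / (1 - α)) ^ 2) / 16 := by
    unfold xlo xhi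
    ring
  rw [h, hs]
  field_simp
  ring

theorem one_lt_f {α t : ℝ} (hα : α ∈ Set.Ioo (0 : ℝ) (1 / 9))
    (ht : t ∈ Set.Ioo (xlo α) (xhi α)) : 1 < f α t := by
  have hβ : 0 < 1 - α := by linarith [hα.2]
  have hden : 0 < α + (1 - α) * t ^ 2 := by
    have := hα.1
    positivity
  have hroots : 0 < (1 - α) * (2 * ((t - xlo α) * (xhi α - t))) := by
    have := sub_pos.2 ht.1
    have := sub_pos.2 ht.2
    positivity
  unfold f
  rw [one_lt_div hden]
  linear_combination hroots - one_sub_mul_xlo_mul_xhi hα + 2 * (1 - α) * t * xlo_add_xhi α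

theorem continuousOn_log_f {α : ℝ} (hα : α ∈ Set.Ioo (0 : ℝ) (1 / 9)) :
    ContinuousOn (fun t => Real.log (f α t)) (Set.Ioo 0 1) := by
  have hβ : 0 < 1 - α := by linarith [hα.2]
  have hden (t : ℝ) : 0 < α + (1 - α) * t ^ 2 := by
    have := hα.1
    positivity
  apply ContinuousOn.log
  · unfold f
    exact ContinuousOn.div (by fun_prop) (by fun_prop) fun t _ => (hden t).ne'
  · intro t ht
    exact (div_pos (mul_pos (mul_pos hβ ht.1) (sub_pos.2 ht.2)) (hden t)).ne'

/-- For `α ∈ (0, 1/9)`, `g_α(x̄_α) > 0`. -/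
theorem g_pos_at_xhi (α : ℝ) (hα : α ∈ Set.Ioo (0 : ℝ) (1 / 9)) :
    0 < g α (xhi α) := by
  have hlt := xlo_lt_xhi hα
  have hlo := xlo_pos hα
  have hsum := xlo_add_xhi α
  refine intervalIntegral.intervalIntegral_pos_of_pos_on ?_
    (fun t ht => Real.log_pos (one_lt_f hα ht)) hlt
  apply ContinuousOn.intervalIntegrable
  rw [Set.uIcc_of_le hlt.le]
  exact (continuousOn_log_f hα).mono fun t ht => ⟨hlo.trans_le ht.1, by linarith [ht.2]⟩
end

section
/- Let α ∈ (0, 1/9). Then g_α(x) converges to a finite limit as x → 1⁻, and this limit is strictly negative. -/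
open Finset

theorem intervalIntegrable_log_f {α : ℝ} (a b : ℝ) :
    IntervalIntegrable (fun t => Real.log (f α t)) MeasureTheory.volume a b := by
  have h : MeromorphicOn (f α) (Set.uIcc a b) := by
    intro x _
    unfold f
    exact AnalyticAt.meromorphicAt (by fun_prop) |>.div (AnalyticAt.meromorphicAt (by fun_prop))
  exact h.intervalIntegrable_log

theorem intervalIntegrable_log_one_sub (a b : ℝ) :
    IntervalIntegrable (fun t : ℝ => Real.log (1 - t)) MeasureTheory.volume a b := by
  simpa using (intervalIntegral.intervalIntegrable_log' (a := 1 - a) (b := 1 - b)).comp_sub_left 1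

theorem integral_log_one_sub_sub_log (a : ℝ) :
    ∫ t in a..1, (Real.log (1 - t) - Real.log t) = -Real.binEntropy a := by
  rw [intervalIntegral.integral_sub (intervalIntegrable_log_one_sub a 1)
      intervalIntegral.intervalIntegrable_log',
    intervalIntegral.integral_comp_sub_left Real.log 1, integral_log, integral_log,
    Real.binEntropy_eq_negMulLog_add_negMulLog_one_sub]
  simp only [Real.negMulLog, Real.log_one, sub_self, Real.log_zero]
  ring

theorem log_f_le {α t : ℝ} (hα : α ∈ Set.Ioo (0 : ℝ) 1) (ht : t ∈ Set.Ioo (0 : ℝ) 1) :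
    Real.log (f α t) ≤ Real.log (1 - t) - Real.log t := by
  obtain ⟨h0, h1⟩ := hα
  obtain ⟨t0, t1⟩ := ht
  have hα' : 0 < 1 - α := sub_pos.2 h1
  have ht' : 0 < 1 - t := sub_pos.2 t1
  rw [← Real.log_div ht'.ne' t0.ne']
  refine Real.log_le_log (by unfold f; positivity) ?_
  rw [f, div_le_div_iff₀ (by positivity) t0]
  nlinarith [mul_pos ht' h0]

theorem xlo_mem_Ioo {α : ℝ} (hα : α ∈ Set.Ioo (0 : ℝ) (1 / 9)) :
    xlo α ∈ Set.Ioo (0 : ℝ) 1 := by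
  obtain ⟨h0, h1⟩ := hα
  have hpos : 0 < 8 * α / (1 - α) := div_pos (by linarith) (by linarith)
  have hlt : √(1 - 8 * α / (1 - α)) < 1 := by
    rw [Real.sqrt_lt' one_pos]
    linarith
  have hnonneg := Real.sqrt_nonneg (1 - 8 * α / (1 - α))
  constructor <;> unfold xlo <;> linarith

/-- For `α ∈ (0, 1/9)`, `g_α(x)` converges to a finite, strictly negative limit as `x → 1⁻`. -/
theorem g_limit_at_one (α : ℝ) (hα : α ∈ Set.Ioo (0 : ℝ) (1 / 9)) :
    ∃ L : ℝ, L < 0 ∧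
      Filter.Tendsto (g α) (nhdsWithin 1 (Set.Iio 1)) (nhds L) := by
  obtain ⟨ha0, ha1⟩ := xlo_mem_Ioo hα
  refine ⟨g α 1, ?_, ?_⟩
  · calc g α 1 ≤ ∫ t in (xlo α)..1, (Real.log (1 - t) - Real.log t) :=
          intervalIntegral.integral_mono_on_of_le_Ioo ha1.le (intervalIntegrable_log_f _ _)
            ((intervalIntegrable_log_one_sub _ _).sub intervalIntegral.intervalIntegrable_log')
            fun t ht => log_f_le ⟨hα.1, hα.2.trans (by norm_num)⟩ ⟨ha0.trans ht.1, ht.2⟩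
      _ = -Real.binEntropy (xlo α) := integral_log_one_sub_sub_log _
      _ < 0 := neg_lt_zero.2 (Real.binEntropy_pos ha0 ha1)
  · exact ((intervalIntegral.continuous_primitive intervalIntegrable_log_f (xlo α)).tendsto
      1).mono_left nhdsWithin_le_nhds
end
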